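/- Let p be a prime and F a finite field extension of ℚ_p. Then no valuation on F is both p-henselian and tamely branching at p. -/

import Mathlib

noncomputable section

/-- The maximal `p`-extension of `K` inside an ambient field extension `Ω`:
the compositum of all finite Galois subextensions of `Ω/K` of `p`-power degree. -/
def maxPExt (p : ℕ) (K Ω : Type*) [Field K] [Field Ω] [Algebra K Ω] :
    IntermediateField K Ω :=
  ⨆ L : {L : IntermediateField K Ω //
      FiniteDimensional K ↥L ∧ IsGalois K ↥L ∧ ∃ n : ℕ, Module.finrank K ↥L = p ^ n}, L.1

/-- A valuation (subring) of `K` is `p`-henselian if it extends uniquely to `K(p)`. -/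
def IsPHenselian (p : ℕ) {K : Type*} [Field K] (O : ValuationSubring K) : Prop :=
  ∃! O' : ValuationSubring ↥(maxPExt p K (AlgebraicClosure K)),
    O'.comap (algebraMap K ↥(maxPExt p K (AlgebraicClosure K))) = O

/-- A valuation (subring) `O` of `K` is tamely branching at the prime `p`:
the residue field has characteristic `≠ p`; the value group `Γ_v = Kˣ/Oˣ` satisfies
`Γ_v ≠ pΓ_v` (expressed as: the subgroup of `Kˣ` generated by `p`-th powers and units of `O`
is proper); and if `[Γ_v : pΓ_v] = p` then the residue field admits a finite separable
extension of degree divisible by `p²`. -/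
def IsTamelyBranching (p : ℕ) {K : Type*} [Field K] (O : ValuationSubring K) : Prop :=
  ringChar (IsLocalRing.ResidueField ↥O) ≠ p ∧
  ((powMonoidHom p : Kˣ →* Kˣ).range ⊔ O.unitGroup) ≠ ⊤ ∧
  (((powMonoidHom p : Kˣ →* Kˣ).range ⊔ O.unitGroup).index = p →
    ∃ L : IntermediateField (IsLocalRing.ResidueField ↥O)
        (AlgebraicClosure (IsLocalRing.ResidueField ↥O)),
      FiniteDimensional (IsLocalRing.ResidueField ↥O) ↥L ∧
      Algebra.IsSeparable (IsLocalRing.ResidueField ↥O) ↥L ∧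
      p ^ 2 ∣ Module.finrank (IsLocalRing.ResidueField ↥O) ↥L)

open Filter Topology in
/-- In a complete field where `p` is nonzero and topologically nilpotent, `1 + p ^ n * a` is a
`p`-th power for some `n`. -/
theorem exists_pow_eq_one_add_pow_mul {L : Type*} [NontriviallyNormedField L] [CompleteSpace L]
    {p : ℕ} (hp0 : (p : L) ≠ 0) (hp1 : ‖(p : L)‖ < 1) (a : L) :
    ∃ (n : ℕ) (y : L), y ^ p = 1 + (p : L) ^ n * a := by
  have hd : HasStrictDerivAt (fun y : L => y ^ p) (p : L) 1 := by
    simpa using hasStrictDerivAt_pow p (1 : L)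
  have hnhds : Set.range (fun y : L => y ^ p) ∈ 𝓝 (1 : L) := by
    have h := hd.map_nhds_eq hp0
    rw [one_pow] at h
    rw [← h]
    exact range_mem_map
  have ht : Tendsto (fun n : ℕ => 1 + (p : L) ^ n * a) atTop (𝓝 1) := by
    simpa using ((tendsto_pow_atTop_nhds_zero_of_norm_lt_one hp1).mul_const a).const_add 1
  obtain ⟨n, y, hy⟩ := (ht.eventually_mem hnhds).exists
  exact ⟨n, y, hy⟩

theorem exists_pow_eq_one_add_pow_mul_of_finiteDimensional_padic (p : ℕ) [Fact p.Prime]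
    {F : Type*} [Field F] [Algebra ℚ_[p] F] [FiniteDimensional ℚ_[p] F] (a : F) :
    ∃ (n : ℕ) (y : F), y ^ p = 1 + (p : F) ^ n * a := by
  have : CharZero F := charZero_of_injective_algebraMap (algebraMap ℚ_[p] F).injective
  let := spectralNorm.nontriviallyNormedField ℚ_[p] F
  have : CompleteSpace F := spectralNorm.completeSpace ℚ_[p] F
  refine exists_pow_eq_one_add_pow_mul (Nat.cast_ne_zero.mpr (Fact.out : p.Prime).ne_zero) ?_ a
  have h : ‖(p : F)‖ = ‖(p : ℚ_[p])‖ := by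
    rw [← map_natCast (algebraMap ℚ_[p] F) p]
    exact spectralNorm_extends _
  exact h.trans_lt Padic.norm_p_lt_one

/-- If the residue characteristic of `O` is not the prime `p`, then `p` is a unit of `O`. -/
theorem ValuationSubring.valuation_natCast_eq_one {K : Type*} [Field K] (O : ValuationSubring K)
    {p : ℕ} (hp : p.Prime) (h : ringChar (IsLocalRing.ResidueField ↥O) ≠ p) :
    O.valuation (p : K) = 1 := by
  have hu : IsUnit (p : O) := by
    rw [← IsLocalRing.residue_ne_zero_iff_isUnit, map_natCast]
    intro h0
    rcases (Nat.dvd_prime hp).mp (ringChar.dvd h0) with h1 | h1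
    · exact CharP.ringChar_ne_one h1
    · exact h h1
  simpa using (O.valuation_eq_one_iff _).mp hu

/-- On a finite extension of `ℚ_p`, every valuation of residue characteristic different from `p`
has a `p`-divisible value group. -/
theorem range_powMonoidHom_sup_unitGroup_eq_top (p : ℕ) [Fact p.Prime] {F : Type*} [Field F]
    [Algebra ℚ_[p] F] [FiniteDimensional ℚ_[p] F] (O : ValuationSubring F)
    (h : ringChar (IsLocalRing.ResidueField ↥O) ≠ p) :
    (powMonoidHom p : Fˣ →* Fˣ).range ⊔ O.unitGroup = ⊤ := by
  have hp : p.Prime := Fact.out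
  have hvp := O.valuation_natCast_eq_one hp h
  have key (a : Fˣ) (ha : 1 < O.valuation (a : F)) :
      a ∈ (powMonoidHom p : Fˣ →* Fˣ).range ⊔ O.unitGroup := by
    obtain ⟨n, y, hy⟩ := exists_pow_eq_one_add_pow_mul_of_finiteDimensional_padic p (a : F)
    have hva : O.valuation ((p : F) ^ n * a) = O.valuation (a : F) := by
      rw [map_mul, map_pow, hvp, one_pow, one_mul]
    have hvy : O.valuation (y ^ p) = O.valuation (a : F) := by
      rw [hy, Valuation.map_add_eq_of_lt_right _ (by rwa [hva, map_one]), hva]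
    have hy0 : y ≠ 0 := by
      rintro rfl
      rw [zero_pow hp.ne_zero, map_zero] at hvy
      exact not_lt_zero (hvy ▸ ha)
    rw [← mul_div_cancel (Units.mk0 y hy0 ^ p) a]
    refine Subgroup.mul_mem_sup ⟨Units.mk0 y hy0, rfl⟩ ?_
    rw [ValuationSubring.mem_unitGroup_iff, Units.val_div_eq_div_val, map_div₀, Units.val_pow_eq_pow_val,
      Units.val_mk0, hvy, div_self]
    exact (zero_lt_one.trans ha).ne'
  refine (Subgroup.eq_top_iff' _).mpr fun a => ?_
  rcases lt_trichotomy (O.valuation (a : F)) 1 with ha | ha | ha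
  · rw [← inv_mem_iff]
    refine key _ ?_
    rw [Units.val_inv_eq_inv_val, map_inv₀]
    exact (one_lt_inv₀ (zero_lt_iff.mpr (by simp))).mpr ha
  · exact Subgroup.mem_sup_right ((O.mem_unitGroup_iff a).mpr ha)
  · exact key a ha

/-- Let `p` be a prime and `F` a finite extension of `ℚ_p`. Then no
valuation on `F` is both `p`-henselian and tamely branching at `p`. -/
theorem statement_3 (p : ℕ) [Fact p.Prime] (F : Type) [Field F] [Algebra ℚ_[p] F]
    [FiniteDimensional ℚ_[p] F] :
    ¬ ∃ O : ValuationSubring F, IsPHenselian p O ∧ IsTamelyBranching p O := by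
  rintro ⟨O, -, hchar, htop, -⟩
  exact htop (range_powMonoidHom_sup_unitGroup_eq_top p O hchar)
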